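/- The triple sum ∑ over positive integers k, m, n with k odd of 1/(3^n · k(k+m)(k+m+n)) equals (13/48)·ζ(3). -/

import Mathlib

open Filter Topology Set

noncomputable def Li (s : ℕ) (x : ℝ) : ℝ := ∑' n : ℕ, x ^ (n + 1) / ((n : ℝ) + 1) ^ s

lemma summ_inv (s : ℕ) (hs : 2 ≤ s) : Summable (fun n : ℕ => 1 / ((n : ℝ) + 1) ^ s) := by
  have := (summable_nat_add_iff 1).2 (Real.summable_one_div_nat_pow.2 (show 1 < s by omega))
  simpa using this

lemma Li_bound (s : ℕ) (x : ℝ) (hx : x ∈ Icc (-1 : ℝ) 1) (n : ℕ) :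
    ‖x ^ (n + 1) / ((n : ℝ) + 1) ^ s‖ ≤ 1 / ((n : ℝ) + 1) ^ s := by
  rw [norm_div, norm_pow, Real.norm_eq_abs, Real.norm_of_nonneg (by positivity)]
  gcongr
  exact pow_le_one₀ (abs_nonneg _) (abs_le.2 hx)

lemma Li_summable (s : ℕ) (hs : 2 ≤ s) (x : ℝ) (hx : x ∈ Icc (-1 : ℝ) 1) :
    Summable (fun n : ℕ => x ^ (n + 1) / ((n : ℝ) + 1) ^ s) :=
  Summable.of_norm_bounded (summ_inv s hs) (Li_bound s x hx)

lemma Li_cont (s : ℕ) (hs : 2 ≤ s) : ContinuousOn (Li s) (Icc (-1 : ℝ) 1) := by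
  unfold Li
  refine continuousOn_tsum (u := fun n : ℕ => 1 / ((n : ℝ) + 1) ^ s) (fun n => by fun_prop)
    (summ_inv s hs) (fun n x hx => Li_bound s x hx n)

lemma Li_zero (s : ℕ) : Li s 0 = 0 := by simp [Li]

lemma Li_deriv0 (s : ℕ) (x : ℝ) (hx : |x| < 1) :
    HasDerivAt (Li (s + 1)) (∑' n : ℕ, x ^ n / ((n : ℝ) + 1) ^ s) x := by
  obtain ⟨r, hr, hr1⟩ := exists_between hx
  have hr0 : 0 ≤ r := (abs_nonneg x).trans hr.le
  unfold Li
  refine hasDerivAt_tsum_of_isPreconnected (t := Metric.ball (0 : ℝ) r) (y₀ := 0)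
    (g := fun (n : ℕ) (x : ℝ) => x ^ (n + 1) / ((n : ℝ) + 1) ^ (s + 1))
    (g' := fun (n : ℕ) (x : ℝ) => x ^ n / ((n : ℝ) + 1) ^ s)
    (u := fun n => r ^ n) (summable_geometric_of_lt_one hr0 hr1) Metric.isOpen_ball
    (convex_ball _ _).isPreconnected ?_ ?_ ?_ ?_ ?_
  · intro n y _
    have := (hasDerivAt_pow (n + 1) y).div_const (((n : ℝ) + 1) ^ (s + 1))
    refine this.congr_deriv ?_
    rw [Nat.add_sub_cancel]
    push_cast
    field_simp
    try ring
  · intro n y hy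
    simp only [Metric.mem_ball, dist_zero_right, Real.norm_eq_abs] at hy
    rw [norm_div, norm_pow, Real.norm_eq_abs, Real.norm_of_nonneg (by positivity)]
    have h1 : |y| ^ n ≤ r ^ n := by gcongr
    have h2 : (1 : ℝ) ≤ ((n : ℝ) + 1) ^ s := one_le_pow₀ (by linarith [n.cast_nonneg (α := ℝ)])
    exact (div_le_self (by positivity) h2).trans h1
  · simpa using lt_of_le_of_lt (abs_nonneg x) hr
  · simp
  · simpa using hr

lemma Li_deriv (s : ℕ) (x : ℝ) (hx : |x| < 1) (h0 : x ≠ 0) :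
    HasDerivAt (Li (s + 1)) (Li s x / x) x := by
  refine (Li_deriv0 s x hx).congr_deriv ?_
  rw [Li, ← tsum_div_const]
  refine tsum_congr fun n => ?_
  field_simp
  ring

lemma Li_one_eq (x : ℝ) (hx : |x| < 1) : Li 1 x = - Real.log (1 - x) := by
  rw [← (Real.hasSum_pow_div_log_of_abs_lt_one hx).tsum_eq]
  simp [Li]

lemma Li2_deriv (x : ℝ) (hx : |x| < 1) (h0 : x ≠ 0) :
    HasDerivAt (Li 2) (- Real.log (1 - x) / x) x := by
  rw [← Li_one_eq x hx]; exact Li_deriv 1 x hx h0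

lemma Li3_deriv (x : ℝ) (hx : |x| < 1) (h0 : x ≠ 0) :
    HasDerivAt (Li 3) (Li 2 x / x) x := Li_deriv 2 x hx h0

lemma Li_dup (s : ℕ) (hs : 2 ≤ s) (x : ℝ) (hx : x ∈ Icc (-1 : ℝ) 1) :
    Li s (x ^ 2) * 2 = 2 ^ s * (Li s x + Li s (-x)) := by
  have h1 := Li_summable s hs x hx
  have h2 := Li_summable s hs (-x) ⟨by linarith [hx.2], by linarith [hx.1]⟩
  rw [Li, Li, Li, ← h1.tsum_add h2]
  have h3 := h1.add h2
  rw [← tsum_even_add_odd (f := fun n : ℕ => x ^ (n + 1) / ((n : ℝ) + 1) ^ s + (-x) ^ (n + 1) / ((n : ℝ) + 1) ^ s)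
    (h3.comp_injective (i := fun k => 2 * k) (fun a b h => by simpa using h))
    (h3.comp_injective (i := fun k => 2 * k + 1) (fun a b h => by simpa using h))]
  have e1 : ∀ k : ℕ, x ^ (2 * k + 1) / (((2 * k : ℕ) : ℝ) + 1) ^ s + (-x) ^ (2 * k + 1) / (((2 * k : ℕ) : ℝ) + 1) ^ s = 0 := by
    intro k
    rw [Odd.neg_pow ⟨k, rfl⟩]; ring
  have e2 : ∀ k : ℕ, x ^ (2 * k + 1 + 1) / (((2 * k + 1 : ℕ) : ℝ) + 1) ^ s + (-x) ^ (2 * k + 1 + 1) / (((2 * k + 1 : ℕ) : ℝ) + 1) ^ s = (2 / 2 ^ s) * ((x ^ 2) ^ (k + 1) / ((k : ℝ) + 1) ^ s) := by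
    intro k
    rw [Even.neg_pow ⟨k + 1, by ring⟩]
    have : (((2 * k + 1 : ℕ) : ℝ) + 1) = 2 * ((k : ℝ) + 1) := by push_cast; ring
    rw [this, mul_pow, ← pow_mul]
    field_simp
    ring
  simp only [e1, e2, tsum_zero, zero_add]
  rw [tsum_mul_left]
  field_simp

lemma Li2_one : Li 2 1 = Real.pi ^ 2 / 6 := by
  have h := hasSum_zeta_two
  have := (hasSum_nat_add_iff' 1).2 h
  simp at this
  rw [Li, ← this.tsum_eq]; simp

lemma Li3_neg_one : Li 3 (-1) = - (3 / 4) * Li 3 1 := by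
  have := Li_dup 3 (by norm_num) 1 (by simp)
  norm_num at this
  linarith

lemma const_lem (f : ℝ → ℝ) (b : ℝ) (hc : ContinuousOn f (Ioc 0 b))
    (hd : ∀ x ∈ Ioo 0 b, HasDerivAt f 0 x) (h0 : Tendsto f (𝓝[>] 0) (𝓝 0)) :
    ∀ x ∈ Ioc 0 b, f x = 0 := by
  intro x hx
  have h : ∀ᶠ y in 𝓝[>] (0 : ℝ), f y = f x := by
    filter_upwards [Ioo_mem_nhdsGT hx.1] with y hy
    obtain ⟨c, hc, h⟩ := exists_hasDerivAt_eq_slope f (fun _ => 0) hy.2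
      (hc.mono fun z hz => ⟨hy.1.trans_le hz.1, hz.2.trans hx.2⟩)
      (fun z hz => hd z ⟨hy.1.trans hz.1, hz.2.trans_le hx.2⟩)
    have : x - y ≠ 0 := by linarith [hy.2]
    field_simp at h
    linarith
  exact tendsto_nhds_unique (tendsto_const_nhds.congr' (h.mono fun _ h => h.symm)) h0

lemma mul_log_lim (g : ℝ → ℝ) (c : ℝ) (hg : HasDerivAt g c 0) (g0 : g 0 = 0) :
    Tendsto (fun t => g t * Real.log t) (𝓝[>] 0) (𝓝 0) := by
  have h1 := hg.tendsto_slope.mono_left (nhdsWithin_mono (0:ℝ) (show Ioi (0:ℝ) ⊆ {0}ᶜ from fun x hx => ne_of_gt hx))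
  have h2 : Tendsto (fun t : ℝ => t * Real.log t) (𝓝[>] 0) (𝓝 0) := by
    have := Real.continuous_mul_log.tendsto 0
    simp only [zero_mul] at this
    exact this.mono_left nhdsWithin_le_nhds
  have := h1.mul h2
  rw [mul_zero] at this
  refine this.congr' ?_
  filter_upwards [self_mem_nhdsWithin] with t ht
  have : t ≠ 0 := ne_of_gt ht
  simp only [slope, g0, vsub_eq_sub, sub_zero, smul_eq_mul]
  field_simp

lemma lim_comp {f g : ℝ → ℝ} {S : Set ℝ} {a : ℝ} (hf : ContinuousOn f S) (hg : ContinuousAt g 0) (ha : g 0 = a)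
    (haS : a ∈ S) (hS : ∀ᶠ t in 𝓝[>] (0 : ℝ), g t ∈ S) :
    Tendsto (fun t => f (g t)) (𝓝[>] 0) (𝓝 (f a)) := by
  refine (hf a haS).tendsto.comp (tendsto_nhdsWithin_iff.2 ⟨?_, hS⟩)
  rw [← ha]
  exact hg.tendsto.mono_left nhdsWithin_le_nhds

lemma d_log1m (x : ℝ) (hx : x ∈ Ioo (0:ℝ) 1) :
    HasDerivAt (fun t => Real.log (1 - t)) (-1 / (1 - x)) x :=
  ((hasDerivAt_id x).const_sub 1).log (by have := hx.2; simp only [id]; linarith)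

lemma d_Li2_1m (x : ℝ) (hx : x ∈ Ioo (0:ℝ) 1) :
    HasDerivAt (fun t => Li 2 (1 - t)) (Real.log x / (1 - x)) x := by
  have h := (Li2_deriv (1 - x) (by rw [abs_lt]; constructor <;> linarith [hx.1, hx.2])
    (by linarith [hx.2])).comp x ((hasDerivAt_id x).const_sub 1)
  refine h.congr_deriv ?_
  rw [sub_sub_cancel]
  ring

lemma d_Li3_1m (x : ℝ) (hx : x ∈ Ioo (0:ℝ) 1) :
    HasDerivAt (fun t => Li 3 (1 - t)) (- Li 2 (1 - x) / (1 - x)) x := by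
  have h := (Li3_deriv (1 - x) (by rw [abs_lt]; constructor <;> linarith [hx.1, hx.2])
    (by linarith [hx.2])).comp x ((hasDerivAt_id x).const_sub 1)
  refine h.congr_deriv ?_
  ring

lemma abs_lt_of_mem {x : ℝ} (hx : x ∈ Ioo (0:ℝ) 1) : |x| < 1 := by
  rw [abs_lt]; constructor <;> linarith [hx.1, hx.2]

lemma ev01 : ∀ᶠ t in 𝓝[>] (0 : ℝ), t ∈ Ioo (0:ℝ) 1 := Ioo_mem_nhdsGT one_pos
lemma evhalf : ∀ᶠ t in 𝓝[>] (0 : ℝ), t ∈ Ioo (0:ℝ) (1/2) := Ioo_mem_nhdsGT (by norm_num)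

lemma lim_Li (s : ℕ) (hs : 2 ≤ s) : Tendsto (fun t => Li s t) (𝓝[>] 0) (𝓝 0) := by
  have := lim_comp (g := fun t => t) (Li_cont s hs) continuousAt_id rfl (by simp)
    (ev01.mono fun t ht => ⟨by linarith [ht.1], ht.2.le⟩)
  rwa [Li_zero] at this

lemma lim_Li1m (s : ℕ) (hs : 2 ≤ s) : Tendsto (fun t => Li s (1 - t)) (𝓝[>] 0) (𝓝 (Li s 1)) :=
  lim_comp (g := fun t => 1 - t) (Li_cont s hs) (by fun_prop) (by simp) (by simp)
    (ev01.mono fun t ht => ⟨by linarith [ht.2], by linarith [ht.1]⟩)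

lemma lim_log1m : Tendsto (fun t => Real.log (1 - t)) (𝓝[>] 0) (𝓝 0) := by
  have : ContinuousAt (fun t : ℝ => Real.log (1 - t)) 0 :=
    ContinuousAt.log (by fun_prop) (by norm_num)
  have := this.tendsto
  simp only [sub_zero, Real.log_one] at this
  exact this.mono_left nhdsWithin_le_nhds

lemma lim_log1p : Tendsto (fun t => Real.log (1 + t)) (𝓝[>] 0) (𝓝 0) := by
  have : ContinuousAt (fun t : ℝ => Real.log (1 + t)) 0 :=
    ContinuousAt.log (by fun_prop) (by norm_num)
  have := this.tendsto
  simp only [add_zero, Real.log_one] at this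
  exact this.mono_left nhdsWithin_le_nhds

lemma lim_log1m_log : Tendsto (fun t => Real.log (1 - t) * Real.log t) (𝓝[>] 0) (𝓝 0) :=
  mul_log_lim _ (-1 / (1 - 0)) (((hasDerivAt_id (0:ℝ)).const_sub 1).log (by norm_num)) (by simp)

lemma lim_log1p_log : Tendsto (fun t => Real.log (1 + t) * Real.log t) (𝓝[>] 0) (𝓝 0) :=
  mul_log_lim _ (1 / (1 + 0)) (((hasDerivAt_id (0:ℝ)).const_add 1).log (by norm_num)) (by simp)

/-- Euler reflection for the dilogarithm. -/
lemma Li2_refl (x : ℝ) (hx : x ∈ Ioo (0:ℝ) 1) :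
    Li 2 x + Li 2 (1 - x) = Li 2 1 - Real.log x * Real.log (1 - x) := by
  have hd : ∀ x ∈ Ioo (0:ℝ) 1,
      HasDerivAt (fun t => Li 2 t + Li 2 (1 - t) + Real.log (1 - t) * Real.log t - Li 2 1) 0 x := by
    intro x hx
    have h := (((Li2_deriv x (abs_lt_of_mem hx) hx.1.ne').add (d_Li2_1m x hx)).add
      ((d_log1m x hx).mul (Real.hasDerivAt_log hx.1.ne'))).sub_const (Li 2 1)
    refine h.congr_deriv ?_
    have h1 := hx.1.ne'
    have h2 : 1 - x ≠ 0 := by linarith [hx.2]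
    field_simp
    ring
  have hl : Tendsto (fun t => Li 2 t + Li 2 (1 - t) + Real.log (1 - t) * Real.log t - Li 2 1)
      (𝓝[>] 0) (𝓝 0) := by
    have := (((lim_Li 2 le_rfl).add (lim_Li1m 2 le_rfl)).add lim_log1m_log).sub_const (Li 2 1)
    simpa using this
  have := const_lem _ x (fun y hy => (hd y ⟨hy.1, hy.2.trans_lt hx.2⟩).continuousAt.continuousWithinAt)
    (fun y hy => hd y ⟨hy.1, hy.2.trans hx.2⟩) hl x ⟨hx.1, le_rfl⟩
  linarith

lemma d_mob (x : ℝ) (hx : x < 1) : HasDerivAt (fun t : ℝ => -t / (1 - t)) (-1 / (1 - x) ^ 2) x := by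
  have h2 : 1 - x ≠ 0 := by linarith
  have := ((hasDerivAt_id x).neg).div ((hasDerivAt_id x).const_sub 1) h2
  refine this.congr_deriv ?_
  simp only [id]
  field_simp
  simp

lemma mob_mem {x : ℝ} (hx : x ∈ Ioo (0:ℝ) (1/2)) : |-x / (1 - x)| < 1 ∧ -x / (1 - x) ≠ 0 := by
  have h1 := hx.1
  have h2 : 0 < 1 - x := by linarith [hx.2]
  constructor
  · rw [abs_div, abs_neg, abs_of_pos h1, abs_of_pos h2, div_lt_one h2]; linarith [hx.2]
  · exact div_ne_zero (by linarith) h2.ne'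

lemma log_mob {x : ℝ} (hx : x < 1) : Real.log (1 - -x / (1 - x)) = - Real.log (1 - x) := by
  rw [← Real.log_inv]; congr 1
  have h2 : 1 - x ≠ 0 := by linarith
  field_simp; ring

lemma lim_mob (s : ℕ) (hs : 2 ≤ s) : Tendsto (fun t => Li s (-t / (1 - t))) (𝓝[>] 0) (𝓝 0) := by
  have := lim_comp (g := fun t : ℝ => -t / (1 - t)) (a := 0) (Li_cont s hs)
    (d_mob 0 one_pos).continuousAt (by simp) (by simp)
    (evhalf.mono fun t ht => abs_le.1 (mob_mem ht).1.le)
  rwa [Li_zero] at this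

lemma d_Li2_mob (x : ℝ) (hx : x ∈ Ioo (0:ℝ) (1/2)) :
    HasDerivAt (fun t => Li 2 (-t / (1 - t))) (Real.log (1 - x) / (x * (1 - x))) x := by
  have h := (Li2_deriv _ (mob_mem hx).1 (mob_mem hx).2).comp x (d_mob x (by linarith [hx.2]))
  refine h.congr_deriv ?_
  rw [log_mob (by linarith [hx.2])]
  have h1 := hx.1.ne'
  have h2 : 1 - x ≠ 0 := by linarith [hx.2]
  field_simp

lemma d_Li3_mob (x : ℝ) (hx : x ∈ Ioo (0:ℝ) (1/2)) :
    HasDerivAt (fun t => Li 3 (-t / (1 - t))) (Li 2 (-x / (1 - x)) / (x * (1 - x))) x := by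
  have h := (Li3_deriv _ (mob_mem hx).1 (mob_mem hx).2).comp x (d_mob x (by linarith [hx.2]))
  refine h.congr_deriv ?_
  have h1 := hx.1.ne'
  have h2 : 1 - x ≠ 0 := by linarith [hx.2]
  generalize Li 2 (-x / (1 - x)) = L
  field_simp

/-- Landen for the dilogarithm. -/
lemma Li2_landen (x : ℝ) (hx : x ∈ Ioo (0:ℝ) (1/2)) :
    Li 2 x + Li 2 (-x / (1 - x)) = - (1/2) * Real.log (1 - x) ^ 2 := by
  have hd : ∀ x ∈ Ioo (0:ℝ) (1/2),
      HasDerivAt (fun t => Li 2 t + Li 2 (-t / (1 - t)) + (1/2) * Real.log (1 - t) ^ 2) 0 x := by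
    intro x hx
    have hx1 : x ∈ Ioo (0:ℝ) 1 := ⟨hx.1, by linarith [hx.2]⟩
    have h := ((Li2_deriv x (abs_lt_of_mem hx1) hx.1.ne').add (d_Li2_mob x hx)).add
      (((d_log1m x hx1).pow 2).const_mul (1/2))
    refine h.congr_deriv ?_
    have h1 := hx.1.ne'
    have h2 : 1 - x ≠ 0 := by linarith [hx.2]
    field_simp
    ring
  have hl : Tendsto (fun t => Li 2 t + Li 2 (-t / (1 - t)) + (1/2) * Real.log (1 - t) ^ 2)
      (𝓝[>] 0) (𝓝 0) := by
    have := ((lim_Li 2 le_rfl).add (lim_mob 2 le_rfl)).add ((lim_log1m.pow 2).const_mul (1/2))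
    simpa using this
  have := const_lem _ x (fun y hy => (hd y ⟨hy.1, hy.2.trans_lt hx.2⟩).continuousAt.continuousWithinAt)
    (fun y hy => hd y ⟨hy.1, hy.2.trans hx.2⟩) hl x ⟨hx.1, le_rfl⟩
  linarith

/-- Landen for the trilogarithm. -/
lemma Li3_landen (x : ℝ) (hx : x ∈ Ioc (0:ℝ) (1/2)) :
    Li 3 (1 - x) + Li 3 x + Li 3 (-x / (1 - x)) = Li 3 1 + Real.log (1 - x) ^ 3 / 6
      + Li 2 1 * Real.log (1 - x) - (1/2) * Real.log (1 - x) ^ 2 * Real.log x := by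
  have hd : ∀ x ∈ Ioo (0:ℝ) (1/2),
      HasDerivAt (fun t => Li 3 (1 - t) + Li 3 t + Li 3 (-t / (1 - t)) - (1/6) * Real.log (1 - t) ^ 3
      - Li 2 1 * Real.log (1 - t) + (1/2) * (Real.log (1 - t) * (Real.log (1 - t) * Real.log t)) - Li 3 1) 0 x := by
    intro x hx
    have hx1 : x ∈ Ioo (0:ℝ) 1 := ⟨hx.1, by linarith [hx.2]⟩
    have h := (((((d_Li3_1m x hx1).add (Li3_deriv x (abs_lt_of_mem hx1) hx.1.ne')).add (d_Li3_mob x hx)).sub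
      (((d_log1m x hx1).pow 3).const_mul (1/6))).sub ((d_log1m x hx1).const_mul (Li 2 1))).add
      (((d_log1m x hx1).mul ((d_log1m x hx1).mul (Real.hasDerivAt_log hx.1.ne'))).const_mul (1/2))
    refine (h.sub_const (Li 3 1)).congr_deriv ?_
    have h1 := hx.1.ne'
    have h2 : 1 - x ≠ 0 := by linarith [hx.2]
    have e1 : Li 2 (1 - x) = Li 2 1 - Real.log x * Real.log (1 - x) - Li 2 x := by
      linarith [Li2_refl x hx1]
    have e2 : Li 2 (-x / (1 - x)) = - (1/2) * Real.log (1 - x) ^ 2 - Li 2 x := by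
      linarith [Li2_landen x hx]
    rw [e1, e2]
    simp only [Pi.mul_apply]
    field_simp
    ring
  have hl : Tendsto (fun t => Li 3 (1 - t) + Li 3 t + Li 3 (-t / (1 - t)) - (1/6) * Real.log (1 - t) ^ 3
      - Li 2 1 * Real.log (1 - t) + (1/2) * (Real.log (1 - t) * (Real.log (1 - t) * Real.log t)) - Li 3 1)
      (𝓝[>] 0) (𝓝 0) := by
    have := ((((((lim_Li1m 3 (by norm_num)).add (lim_Li 3 (by norm_num))).add (lim_mob 3 (by norm_num))).sub
      ((lim_log1m.pow 3).const_mul (1/6))).sub (lim_log1m.const_mul (Li 2 1))).add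
      ((lim_log1m.mul lim_log1m_log).const_mul (1/2))).sub_const (Li 3 1)
    simpa using this
  have hc : ContinuousOn (fun t => Li 3 (1 - t) + Li 3 t + Li 3 (-t / (1 - t)) - (1/6) * Real.log (1 - t) ^ 3
      - Li 2 1 * Real.log (1 - t) + (1/2) * (Real.log (1 - t) * (Real.log (1 - t) * Real.log t)) - Li 3 1)
      (Ioc 0 (1/2)) := by
    have c0 := Li_cont 3 (by norm_num)
    have c1 : ContinuousOn (fun t : ℝ => Li 3 (1 - t)) (Ioc 0 (1/2)) :=
      c0.comp (by fun_prop) (fun t ht => ⟨by linarith [ht.2], by linarith [ht.1]⟩)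
    have c2 : ContinuousOn (fun t : ℝ => Li 3 t) (Ioc 0 (1/2)) :=
      c0.mono (fun t ht => ⟨by linarith [ht.1], by linarith [ht.2]⟩)
    have c3 : ContinuousOn (fun t : ℝ => Li 3 (-t / (1 - t))) (Ioc 0 (1/2)) := by
      refine c0.comp (fun t ht => (d_mob t (by linarith [ht.2])).continuousAt.continuousWithinAt) (fun t ht => ?_)
      have h2 : 0 < 1 - t := by linarith [ht.2]
      refine abs_le.1 ?_
      rw [abs_div, abs_neg, abs_of_pos ht.1, abs_of_pos h2, div_le_one h2]; linarith [ht.2]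
    have c4 : ContinuousOn (fun t : ℝ => Real.log (1 - t)) (Ioc 0 (1/2)) :=
      ContinuousOn.log (by fun_prop) (fun t ht => by linarith [ht.2])
    have c5 : ContinuousOn (fun t : ℝ => Real.log t) (Ioc 0 (1/2)) :=
      ContinuousOn.log (by fun_prop) (fun t ht => ht.1.ne')
    fun_prop
  have := const_lem _ (1/2) hc hd hl x hx
  linarith

noncomputable def NN (t : ℝ) : ℝ := Real.log (1 - t) * (Real.log (1 - t) * Real.log t)
  + 2 * (Real.log (1 - t) * Li 2 (1 - t)) - 2 * Li 3 (1 - t) + 2 * Li 3 1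

lemma d_NN (x : ℝ) (hx : x ∈ Ioo (0:ℝ) 1) : HasDerivAt NN (Real.log (1 - x) ^ 2 / x) x := by
  have h := ((((d_log1m x hx).mul ((d_log1m x hx).mul (Real.hasDerivAt_log hx.1.ne'))).add
    (((d_log1m x hx).mul (d_Li2_1m x hx)).const_mul 2)).sub ((d_Li3_1m x hx).const_mul 2)).add_const (2 * Li 3 1)
  refine h.congr_deriv ?_
  have h1 := hx.1.ne'
  have h2 : 1 - x ≠ 0 := by linarith [hx.2]
  simp only [Pi.mul_apply]
  field_simp
  ring

lemma lim_NN : Tendsto NN (𝓝[>] 0) (𝓝 0) := by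
  have := (((lim_log1m.mul lim_log1m_log).add ((lim_log1m.mul (lim_Li1m 2 le_rfl)).const_mul 2)).sub
    ((lim_Li1m 3 (by norm_num)).const_mul 2)).add_const (2 * Li 3 1)
  simp only [zero_mul, mul_zero, add_zero, zero_sub, neg_add_cancel] at this
  exact this

noncomputable def PP (t : ℝ) : ℝ := (1/2) * NN (t ^ 2)

lemma sq_mem {x : ℝ} (hx : x ∈ Ioo (0:ℝ) 1) : x ^ 2 ∈ Ioo (0:ℝ) 1 :=
  ⟨by have := hx.1; positivity, by nlinarith [hx.1, hx.2]⟩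

lemma log_sq {x : ℝ} (hx : x ∈ Ioo (0:ℝ) 1) :
    Real.log (1 - x ^ 2) = Real.log (1 - x) + Real.log (1 + x) := by
  rw [← Real.log_mul (by linarith [hx.2]) (by linarith [hx.1])]; congr 1; ring

lemma d_PP (x : ℝ) (hx : x ∈ Ioo (0:ℝ) 1) :
    HasDerivAt PP ((Real.log (1 - x) + Real.log (1 + x)) ^ 2 / x) x := by
  have h := (HasDerivAt.comp (h := fun t : ℝ => t ^ 2) x (d_NN (x ^ 2) (sq_mem hx)) (hasDerivAt_pow 2 x)).const_mul (1/2)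
  refine h.congr_deriv ?_
  rw [log_sq hx]
  have h1 := hx.1.ne'
  field_simp
  ring

lemma lim_PP : Tendsto PP (𝓝[>] 0) (𝓝 0) := by
  have h : Tendsto (fun t : ℝ => t ^ 2) (𝓝[>] 0) (𝓝[>] 0) := by
    refine tendsto_nhdsWithin_iff.2 ⟨?_, ?_⟩
    · have : Tendsto (fun t : ℝ => t ^ 2) (𝓝 0) (𝓝 (0 ^ 2)) := (continuous_pow 2).tendsto 0
      simp only [ne_eq, OfNat.ofNat_ne_zero, not_false_eq_true, zero_pow] at this
      exact this.mono_left nhdsWithin_le_nhds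
    · filter_upwards [ev01] with t ht
      exact (sq_mem ht).1
  have := (lim_NN.comp h).const_mul (1/2)
  simp only [mul_zero] at this
  exact this

lemma d_log1p (x : ℝ) (hx : 0 < x) :
    HasDerivAt (fun t => Real.log (1 + t)) (1 / (1 + x)) x :=
  ((hasDerivAt_id x).const_add 1).log (by simp only [id]; linarith)

lemma d_inv1p (x : ℝ) (hx : 0 ≤ x) : HasDerivAt (fun t : ℝ => (1 + t)⁻¹) (-1 / (1 + x) ^ 2) x :=
  ((hasDerivAt_id x).const_add 1).inv (by simp only [id]; linarith)

lemma inv1p_mem {x : ℝ} (hx : 0 < x) : (1 + x)⁻¹ ∈ Ioo (0:ℝ) 1 :=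
  ⟨by positivity, inv_lt_one_of_one_lt₀ (by linarith)⟩

lemma lim_inv1p (s : ℕ) (hs : 2 ≤ s) : Tendsto (fun t => Li s (1 + t)⁻¹) (𝓝[>] 0) (𝓝 (Li s 1)) :=
  lim_comp (g := fun t : ℝ => (1 + t)⁻¹) (Li_cont s hs) (d_inv1p 0 le_rfl).continuousAt (by simp) (by simp)
    (ev01.mono fun t ht => ⟨by linarith [(inv1p_mem ht.1).1], (inv1p_mem ht.1).2.le⟩)

noncomputable def MM (t : ℝ) : ℝ := Real.log (1 + t) * (Real.log (1 + t) * Real.log t)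
  - (2/3) * Real.log (1 + t) ^ 3
  - 2 * (Real.log (1 + t) * Li 2 (1 + t)⁻¹) - 2 * Li 3 (1 + t)⁻¹ + 2 * Li 3 1

lemma d_MM (x : ℝ) (hx : 0 < x) : HasDerivAt MM (Real.log (1 + x) ^ 2 / x) x := by
  have hm := inv1p_mem hx
  have e2 := (Li2_deriv _ (abs_lt_of_mem hm) hm.1.ne').comp x (d_inv1p x hx.le)
  have e3 := (Li3_deriv _ (abs_lt_of_mem hm) hm.1.ne').comp x (d_inv1p x hx.le)
  have h := (((((d_log1p x hx).mul ((d_log1p x hx).mul (Real.hasDerivAt_log hx.ne'))).sub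
    (((d_log1p x hx).pow 3).const_mul (2/3))).sub
    (((d_log1p x hx).mul e2).const_mul 2)).sub (e3.const_mul 2)).add_const (2 * Li 3 1)
  refine h.congr_deriv ?_
  have h2 : 1 + x ≠ 0 := by linarith
  have : Real.log (1 - (1 + x)⁻¹) = Real.log x - Real.log (1 + x) := by
    rw [← Real.log_div hx.ne' h2]; congr 1; field_simp; ring
  simp only [Pi.mul_apply, this, Function.comp]
  generalize Li 2 (1 + x)⁻¹ = L
  field_simp
  ring

lemma lim_MM : Tendsto MM (𝓝[>] 0) (𝓝 0) := by
  have := ((((lim_log1p.mul lim_log1p_log).sub ((lim_log1p.pow 3).const_mul (2/3))).sub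
    ((lim_log1p.mul (lim_inv1p 2 le_rfl)).const_mul 2)).sub
    ((lim_inv1p 3 (by norm_num)).const_mul 2)).add_const (2 * Li 3 1)
  simp only [zero_mul, mul_zero, add_zero, zero_sub, neg_add_cancel, ne_eq, OfNat.ofNat_ne_zero,
    not_false_eq_true, zero_pow, sub_zero] at this
  exact this

lemma d_v (x : ℝ) (hx : 0 ≤ x) : HasDerivAt (fun t : ℝ => (1 - t) / (1 + t)) (-2 / (1 + x) ^ 2) x := by
  have h2 : 1 + x ≠ 0 := by linarith
  have := ((hasDerivAt_id x).const_sub 1).div ((hasDerivAt_id x).const_add 1) h2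
  refine this.congr_deriv ?_
  simp only [id]
  field_simp
  ring

lemma v_mem {x : ℝ} (hx : x ∈ Ioo (0:ℝ) 1) : (1 - x) / (1 + x) ∈ Ioo (0:ℝ) 1 := by
  have h1 := hx.1
  have h2 : 0 < 1 - x := by linarith [hx.2]
  exact ⟨by positivity, by rw [div_lt_one (by positivity)]; linarith⟩

lemma lim_v (s : ℕ) (hs : 2 ≤ s) : Tendsto (fun t => Li s ((1 - t) / (1 + t))) (𝓝[>] 0) (𝓝 (Li s 1)) :=
  lim_comp (g := fun t : ℝ => (1 - t) / (1 + t)) (Li_cont s hs) (d_v 0 le_rfl).continuousAt (by simp) (by simp)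
    (ev01.mono fun t ht => ⟨by linarith [(v_mem ht).1], (v_mem ht).2.le⟩)

lemma lim_nv (s : ℕ) (hs : 2 ≤ s) : Tendsto (fun t => Li s (-((1 - t) / (1 + t)))) (𝓝[>] 0) (𝓝 (Li s (-1))) :=
  lim_comp (g := fun t : ℝ => -((1 - t) / (1 + t))) (Li_cont s hs) (d_v 0 le_rfl).neg.continuousAt (by simp) (by simp)
    (ev01.mono fun t ht => ⟨by linarith [(v_mem ht).2], by linarith [(v_mem ht).1]⟩)

lemma d_Li2_neg (x : ℝ) (hx : x ∈ Ioo (0:ℝ) 1) :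
    HasDerivAt (fun t => Li 2 (-t)) (-Real.log (1 + x) / x) x := by
  have h := (Li2_deriv (-x) (by rw [abs_neg]; exact abs_lt_of_mem hx) (neg_ne_zero.2 hx.1.ne')).comp x (hasDerivAt_neg x)
  refine h.congr_deriv ?_
  rw [sub_neg_eq_add]
  have := hx.1.ne'
  field_simp

lemma d_Li3_neg (x : ℝ) (hx : x ∈ Ioo (0:ℝ) 1) :
    HasDerivAt (fun t => Li 3 (-t)) (Li 2 (-x) / x) x := by
  have h := (Li3_deriv (-x) (by rw [abs_neg]; exact abs_lt_of_mem hx) (neg_ne_zero.2 hx.1.ne')).comp x (hasDerivAt_neg x)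
  refine h.congr_deriv ?_
  have := hx.1.ne'
  field_simp

noncomputable def QQ (t : ℝ) : ℝ :=
  (Real.log (1 - t) - Real.log (1 + t)) * (Real.log (1 - t) * Real.log t - Real.log (1 + t) * Real.log t)
  + 2 * ((Real.log (1 - t) - Real.log (1 + t)) * (Li 2 ((1 - t) / (1 + t)) - Li 2 (-((1 - t) / (1 + t)))))
  - 2 * (Li 3 ((1 - t) / (1 + t)) - Li 3 (-((1 - t) / (1 + t)))) + (7/2) * Li 3 1

lemma d_QQ (x : ℝ) (hx : x ∈ Ioo (0:ℝ) 1) :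
    HasDerivAt QQ ((Real.log (1 - x) - Real.log (1 + x)) ^ 2 / x) x := by
  have hm := v_mem hx
  have dv := d_v x hx.1.le
  have e2 := (Li2_deriv _ (abs_lt_of_mem hm) hm.1.ne').comp x dv
  have e3 := (Li3_deriv _ (abs_lt_of_mem hm) hm.1.ne').comp x dv
  have f2 := (d_Li2_neg _ hm).comp x dv
  have f3 := (d_Li3_neg _ hm).comp x dv
  have dV := (d_log1m x hx).sub (d_log1p x hx.1)
  have dl := Real.hasDerivAt_log hx.1.ne'
  have h := (((dV.mul (((d_log1m x hx).mul dl).sub ((d_log1p x hx.1).mul dl))).add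
    ((dV.mul (e2.sub f2)).const_mul 2)).sub ((e3.sub f3).const_mul 2)).add_const ((7/2) * Li 3 1)
  refine h.congr_deriv ?_
  have h0 := hx.1.ne'
  have h1 : 1 - x ≠ 0 := by linarith [hx.2]
  have h2 : 1 + x ≠ 0 := by linarith [hx.1]
  have g1 : Real.log (1 - (1 - x) / (1 + x)) = Real.log 2 + Real.log x - Real.log (1 + x) := by
    rw [← Real.log_mul (by norm_num) h0, ← Real.log_div (by positivity) h2]; congr 1; field_simp; ring
  have g2 : Real.log (1 + (1 - x) / (1 + x)) = Real.log 2 - Real.log (1 + x) := by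
    rw [← Real.log_div (by norm_num) h2]; congr 1; field_simp; ring
  simp only [Pi.mul_apply, Pi.sub_apply, Function.comp, g1, g2]
  generalize Li 2 ((1 - x) / (1 + x)) = L
  generalize Li 2 (-((1 - x) / (1 + x))) = L'
  field_simp
  ring

lemma lim_QQ : Tendsto QQ (𝓝[>] 0) (𝓝 0) := by
  have lV := lim_log1m.sub lim_log1p
  have := (((lV.mul (lim_log1m_log.sub lim_log1p_log)).add
    ((lV.mul ((lim_v 2 le_rfl).sub (lim_nv 2 le_rfl))).const_mul 2)).sub
    (((lim_v 3 (by norm_num)).sub (lim_nv 3 (by norm_num))).const_mul 2)).add_const ((7/2) * Li 3 1)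
  rw [Li3_neg_one] at this
  convert! this using 2
  ring

lemma quad (x : ℝ) (hx : x ∈ Ioo (0:ℝ) 1) : PP x + QQ x = 2 * NN x + 2 * MM x := by
  have hd : ∀ x ∈ Ioo (0:ℝ) 1, HasDerivAt (fun t => PP t + QQ t - 2 * NN t - 2 * MM t) 0 x := by
    intro x hx
    refine ((((d_PP x hx).add (d_QQ x hx)).sub ((d_NN x hx).const_mul 2)).sub
      ((d_MM x hx.1).const_mul 2)).congr_deriv ?_
    ring
  have hl : Tendsto (fun t => PP t + QQ t - 2 * NN t - 2 * MM t) (𝓝[>] 0) (𝓝 0) := by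
    have := ((lim_PP.add lim_QQ).sub (lim_NN.const_mul 2)).sub (lim_MM.const_mul 2)
    simpa using this
  have := const_lem _ x (fun y hy => (hd y ⟨hy.1, hy.2.trans_lt hx.2⟩).continuousAt.continuousWithinAt)
    (fun y hy => hd y ⟨hy.1, hy.2.trans hx.2⟩) hl x ⟨hx.1, le_rfl⟩
  linarith

noncomputable def GG (t : ℝ) : ℝ := - (Li 2 (-t) * Real.log t) + Li 3 (-t) - (1/4) * (PP t - QQ t)

lemma d_GG (x : ℝ) (hx : x ∈ Ioo (0:ℝ) 1) :
    HasDerivAt GG (Real.log (1 + x) * (Real.log x - Real.log (1 - x)) / x) x := by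
  refine ((((d_Li2_neg x hx).mul (Real.hasDerivAt_log hx.1.ne')).neg.add (d_Li3_neg x hx)).sub
    (((d_PP x hx).sub (d_QQ x hx)).const_mul (1/4))).congr_deriv ?_
  have h0 := hx.1.ne'
  field_simp
  ring

lemma lim_GG : Tendsto GG (𝓝[>] 0) (𝓝 0) := by
  have h1 : Tendsto (fun t => Li 2 (-t) * Real.log t) (𝓝[>] 0) (𝓝 0) := by
    have := (Li_deriv0 1 (-0) (by simp)).comp 0 (hasDerivAt_neg (0:ℝ))
    exact mul_log_lim (fun t => Li 2 (-t)) _ this (by simp [Li_zero])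
  have h2 : Tendsto (fun t => Li 3 (-t)) (𝓝[>] 0) (𝓝 0) := by
    have := lim_comp (g := fun t : ℝ => -t) (a := 0) (Li_cont 3 (by norm_num)) (by fun_prop) (by simp) (by simp)
      (ev01.mono fun t ht => ⟨by linarith [ht.2], by linarith [ht.1]⟩)
    rwa [Li_zero] at this
  have := (h1.neg.add h2).sub ((lim_PP.sub lim_QQ).const_mul (1/4))
  simp only [neg_zero, add_zero, sub_zero, mul_zero] at this
  exact this

lemma GG_half : GG (1/2) = - (13/24) * Li 3 1 := by
  have q := quad (1/2) (by norm_num)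
  have l1 := Li3_landen (1/2) (by norm_num)
  have l2 := Li3_landen (1/3) (by norm_num)
  have l3 := Li3_landen (1/4) (by norm_num)
  have r1 := Li2_refl (1/2) (by norm_num)
  have r2 := Li2_refl (1/3) (by norm_num)
  have r3 := Li2_refl (1/4) (by norm_num)
  have s2 := Li2_landen (1/3) (by norm_num)
  have s3 := Li2_landen (1/4) (by norm_num)
  have d2 := Li_dup 2 (by norm_num) (1/2) (by norm_num)
  have d3 := Li_dup 3 (by norm_num) (1/2) (by norm_num)
  have g12 : Real.log (1/2) = - Real.log 2 := by rw [one_div, Real.log_inv]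
  have g13 : Real.log (1/3) = - Real.log 3 := by rw [one_div, Real.log_inv]
  have g4 : Real.log 4 = 2 * Real.log 2 := by
    rw [show (4:ℝ) = 2 ^ 2 by norm_num, Real.log_pow]; norm_num
  have g14 : Real.log (1/4) = - (2 * Real.log 2) := by rw [one_div, Real.log_inv, g4]
  have g23 : Real.log (2/3) = Real.log 2 - Real.log 3 := Real.log_div (by norm_num) (by norm_num)
  have g32 : Real.log (3/2) = Real.log 3 - Real.log 2 := Real.log_div (by norm_num) (by norm_num)
  have g34 : Real.log (3/4) = Real.log 3 - 2 * Real.log 2 := by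
    rw [Real.log_div (by norm_num) (by norm_num), g4]
  have n1 := Li3_neg_one
  rw [GG]
  simp only [PP, QQ, NN, MM] at q ⊢
  norm_num [g12, g13, g14, g23, g32, g34, n1] at q l1 l2 l3 r1 r2 r3 s2 s3 d2 d3 ⊢
  generalize Real.log 2 = a at *
  generalize Real.log 3 = b at *
  have t1 : Li 2 (1/2) = (Li 2 1 - a * a) / 2 := by linarith
  have t2 : Li 2 (1/4) = (Li 2 1 - a * a) + 2 * Li 2 (-(1/2)) := by linarith
  have t3 : Li 2 (1/3) = -(1 / 2 * (a - b) ^ 2) - Li 2 (-(1/2)) := by linarith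
  have t4 : Li 2 (2/3) = Li 2 1 + b * (a - b) + (1 / 2 * (a - b) ^ 2) + Li 2 (-(1/2)) := by linarith
  have t5 : Li 2 (3/4) = 2 * a * (b - 2 * a) + a * a - 2 * Li 2 (-(1/2)) := by linarith
  have t6 : Li 2 (-(1/3)) = -(1 / 2 * (b - 2 * a) ^ 2) - (Li 2 1 - a * a) - 2 * Li 2 (-(1/2)) := by linarith
  rw [t1, t3, t4, t5, t6] at q
  rw [t3, t5, t6]
  linarith

open MeasureTheory

lemma nn_lem (f : ℕ → ℝ → ℝ) (F : ℝ → ℝ) (hm : ∀ n, ContinuousOn (f n) (Ioo 0 1))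
    (h0 : ∀ n, ∀ u ∈ Ioo (0:ℝ) 1, 0 ≤ f n u) (hs : ∀ u ∈ Ioo (0:ℝ) 1, HasSum (fun n => f n u) (F u))
    (hF : IntegrableOn F (Ioo 0 1)) :
    ∑' n, ∫ u in Ioo (0:ℝ) 1, f n u = ∫ u in Ioo (0:ℝ) 1, F u := by
  have hae : ∀ {p : ℝ → Prop}, (∀ u ∈ Ioo (0:ℝ) 1, p u) → ∀ᵐ u ∂(volume.restrict (Ioo (0:ℝ) 1)), p u :=
    fun h => (ae_restrict_iff' measurableSet_Ioo).2 (Eventually.of_forall h)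
  refine (hasSum_integral_of_dominated_convergence f
    (fun n => (hm n).aestronglyMeasurable measurableSet_Ioo) ?_ ?_ ?_ (hae hs)).tsum_eq
  · exact fun n => hae fun u hu => by rw [Real.norm_of_nonneg (h0 n u hu)]
  · exact hae fun u hu => (hs u hu).summable
  · exact hF.congr (hae fun u hu => (hs u hu).tsum_eq.symm)

noncomputable def LL (u : ℝ) : ℝ := Real.log ((3 - u) / 2)

lemma LL_cont : ContinuousOn LL (Icc 0 1) := by
  unfold LL
  exact ContinuousOn.log (by fun_prop) (fun t ht => by have := ht.2; simp; linarith)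

lemma LL_bd (u : ℝ) (hu : u ∈ Ioo (0:ℝ) 1) : 0 ≤ LL u ∧ LL u / (1 - u) ≤ 1 / 2 := by
  have h2 : 0 < 1 - u := by linarith [hu.2]
  constructor
  · exact Real.log_nonneg (by linarith)
  · rw [div_le_iff₀ h2]
    have := Real.log_le_sub_one_of_pos (show 0 < (3 - u) / 2 by linarith)
    rw [LL]; linarith

lemma step1 (B : ℕ) : ∑' n : ℕ, (1:ℝ) / (3 ^ (n + 1) * ((B:ℝ) + 1 + (n + 1)))
    = ∫ u in Ioo (0:ℝ) 1, ((B:ℝ) + 1) * u ^ B * LL u := by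
  have e1 : ∀ n : ℕ, (1:ℝ) / (3 ^ (n + 1) * ((B:ℝ) + 1 + (n + 1))) = ∫ u in Ioo (0:ℝ) 1, u ^ (B + 1 + n) / 3 ^ (n + 1) := by
    intro n
    rw [← integral_Ioc_eq_integral_Ioo, ← intervalIntegral.integral_of_le zero_le_one,
      intervalIntegral.integral_div, integral_pow]
    push_cast
    simp
    field_simp
    ring
  have c1 : ContinuousOn (fun u : ℝ => u ^ (B + 1) / (3 - u)) (Icc 0 1) :=
    ContinuousOn.div (by fun_prop) (by fun_prop) (fun t ht => by linarith [ht.2])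
  have c2 : ContinuousOn (fun u : ℝ => ((B:ℝ) + 1) * u ^ B * LL u) (Icc 0 1) := by
    have := LL_cont
    fun_prop
  simp_rw [e1]
  rw [nn_lem _ (fun u => u ^ (B + 1) / (3 - u)) (fun n => by fun_prop) (fun n u hu => by have := hu.1; positivity) ?_
    ((c1.integrableOn_Icc).mono_set Ioo_subset_Icc_self)]
  · rw [← integral_Ioc_eq_integral_Ioo, ← intervalIntegral.integral_of_le zero_le_one,
      ← integral_Ioc_eq_integral_Ioo, ← intervalIntegral.integral_of_le zero_le_one, ← sub_eq_zero]
    have i1 := ContinuousOn.intervalIntegrable_of_Icc (μ := volume) zero_le_one c1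
    have i2 := ContinuousOn.intervalIntegrable_of_Icc (μ := volume) zero_le_one c2
    rw [← intervalIntegral.integral_sub i1 i2]
    rw [intervalIntegral.integral_eq_sub_of_hasDerivAt_of_le (f := fun u => - (u ^ (B + 1) * LL u)) zero_le_one ?_ ?_ (i1.sub i2)]
    · simp [LL]; norm_num
    · have := LL_cont
      fun_prop
    · intro u hu
      have hne : (3 - u) ≠ 0 := by linarith [hu.2]
      have dL : HasDerivAt LL (-1 / 2 / ((3 - u) / 2)) u :=
        (((hasDerivAt_id u).const_sub 3).div_const 2).log (by simpa using hne)
      refine ((hasDerivAt_pow (B + 1) u).mul dL).neg.congr_deriv ?_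
      rw [Nat.add_sub_cancel]
      push_cast
      field_simp
      ring
  · intro u hu
    have hne : (3 - u) ≠ 0 := by linarith [hu.2]
    have := (hasSum_geometric_of_lt_one (show 0 ≤ u / 3 by linarith [hu.1]) (by linarith [hu.2])).mul_left (u ^ (B + 1) / 3)
    convert! this using 1
    · ext n; rw [div_pow, pow_add]; field_simp; ring
    · have : 1 - u / 3 ≠ 0 := by linarith [hu.2]
      field_simp

lemma FF_int : IntegrableOn (fun u => (1/2) * (Real.log (1 + u) - Real.log (1 - u)) * (LL u / (1 - u))) (Ioo 0 1) ∧
    ∫ u in Ioo (0:ℝ) 1, (1/2) * (Real.log (1 + u) - Real.log (1 - u)) * (LL u / (1 - u)) = (13/48) * Li 3 1 := by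
  have G0 : GG 0 = 0 := by
    simp [GG, PP, QQ, NN, Li_zero, Li3_neg_one]; ring
  have cG : ContinuousOn GG (Icc 0 (1/2)) := by
    intro x hx
    rcases hx.1.eq_or_lt with h | h
    · subst h
      have : ContinuousWithinAt GG (Ioi 0) 0 := by
        rw [ContinuousWithinAt, G0]; exact lim_GG
      exact (continuousWithinAt_Ioi_iff_Ici.1 this).mono Icc_subset_Ici_self
    · exact (d_GG x ⟨h, by linarith [hx.2]⟩).continuousAt.continuousWithinAt
  have c : ContinuousOn (fun u : ℝ => (1/2) * GG ((1 - u) / 2)) (Icc 0 1) := by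
    refine continuousOn_const.mul (cG.comp (by fun_prop) ?_)
    intro u hu
    exact ⟨by linarith [hu.2], by linarith [hu.1]⟩
  have d : ∀ u ∈ Ioo (0:ℝ) 1, HasDerivAt (fun u : ℝ => (1/2) * GG ((1 - u) / 2))
      ((1/2) * (Real.log (1 + u) - Real.log (1 - u)) * (LL u / (1 - u))) u := by
    intro u hu
    have h1 : (1 - u) ≠ 0 := by linarith [hu.2]
    have h2 : (1 + u) ≠ 0 := by linarith [hu.1]
    have h := ((d_GG ((1 - u) / 2) ⟨by linarith [hu.2], by linarith [hu.1]⟩).comp u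
      (((hasDerivAt_id u).const_sub 1).div_const 2)).const_mul (1/2)
    refine h.congr_deriv ?_
    rw [show 1 + (1 - u) / 2 = (3 - u) / 2 by ring, show 1 - (1 - u) / 2 = (1 + u) / 2 by ring,
      Real.log_div h1 (by norm_num), Real.log_div h2 (by norm_num), LL]
    field_simp
    ring
  have p : ∀ u ∈ Ioo (0:ℝ) 1, 0 ≤ (1/2) * (Real.log (1 + u) - Real.log (1 - u)) * (LL u / (1 - u)) := by
    intro u hu
    have h1 : 0 < 1 - u := by linarith [hu.2]
    have := Real.log_le_log h1 (show 1 - u ≤ 1 + u by linarith [hu.1])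
    have h3 := (LL_bd u hu).1
    exact mul_nonneg (by linarith) (by positivity)
  have i := intervalIntegral.integrableOn_deriv_of_nonneg c d p
  refine ⟨i.mono_set Ioo_subset_Ioc_self, ?_⟩
  rw [← integral_Ioc_eq_integral_Ioo, ← intervalIntegral.integral_of_le zero_le_one,
    intervalIntegral.integral_eq_sub_of_hasDerivAt_of_le zero_le_one c d
      ((intervalIntegrable_iff_integrableOn_Ioc_of_le zero_le_one).2 i)]
  simp only [sub_self, zero_div, sub_zero, G0, GG_half]
  ring

lemma step2 (a : ℕ) : ∑' m : ℕ, ∫ u in Ioo (0:ℝ) 1, u ^ (2 * a + 1 + m) * LL u / (2 * a + 1)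
    = ∫ u in Ioo (0:ℝ) 1, u ^ (2 * a + 1) / (2 * a + 1) * (LL u / (1 - u)) := by
  have cL := LL_cont.mono Ioo_subset_Icc_self
  refine nn_lem _ _ (fun m => by fun_prop) ?_ ?_ ?_
  · intro m u hu
    have := (LL_bd u hu).1
    have := hu.1
    positivity
  · intro u hu
    have := (hasSum_geometric_of_lt_one hu.1.le hu.2).mul_left (u ^ (2 * a + 1) / (2 * a + 1) * LL u)
    convert! this using 1
    · ext n; rw [pow_add]; ring
    · ring
  · have hc : ContinuousOn (fun u : ℝ => u ^ (2 * a + 1) / (2 * a + 1) * (LL u / (1 - u))) (Ioo 0 1) :=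
      ContinuousOn.mul (by fun_prop) (cL.div (by fun_prop) (fun u hu => by linarith [hu.2]))
    refine Integrable.of_bound (hc.aestronglyMeasurable measurableSet_Ioo) 1 ?_
    refine (ae_restrict_iff' measurableSet_Ioo).2 (Eventually.of_forall fun u hu => ?_)
    have h1 : 0 < 1 - u := by linarith [hu.2]
    have h2 := LL_bd u hu
    have h3 := hu.1
    have h4 := h2.1
    rw [Real.norm_of_nonneg (by positivity)]
    have h5 : u ^ (2 * a + 1) / (2 * a + 1) ≤ 1 := by
      rw [div_le_one (by positivity)]
      have := pow_le_one₀ (n := 2 * a + 1) hu.1.le hu.2.le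
      linarith [a.cast_nonneg (α := ℝ)]
    calc _ ≤ (1:ℝ) * (1/2) := by
          exact mul_le_mul h5 h2.2 (by positivity) zero_le_one
      _ ≤ 1 := by norm_num

theorem companion_triple_sum :
    (∑' a : ℕ, ∑' m : ℕ, ∑' n : ℕ,
      (1:ℝ) / (3 ^ (n + 1) * ((2 * (a:ℝ) + 1) * ((2 * (a:ℝ) + 1) + ((m:ℝ) + 1)) *
        ((2 * (a:ℝ) + 1) + ((m:ℝ) + 1) + ((n:ℝ) + 1)))))
    = (13/48) * ∑' n : ℕ, 1 / ((n:ℝ) + 1) ^ 3 := by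
  have e1 : ∀ a m : ℕ, ∑' n : ℕ,
      (1:ℝ) / (3 ^ (n + 1) * ((2 * (a:ℝ) + 1) * ((2 * (a:ℝ) + 1) + ((m:ℝ) + 1)) *
        ((2 * (a:ℝ) + 1) + ((m:ℝ) + 1) + ((n:ℝ) + 1))))
      = ∫ u in Ioo (0:ℝ) 1, u ^ (2 * a + 1 + m) * LL u / (2 * a + 1) := by
    intro a m
    have h := step1 (2 * a + 1 + m)
    have h2 : ∀ n : ℕ, (1:ℝ) / (3 ^ (n + 1) * ((2 * (a:ℝ) + 1) * ((2 * (a:ℝ) + 1) + ((m:ℝ) + 1)) *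
        ((2 * (a:ℝ) + 1) + ((m:ℝ) + 1) + ((n:ℝ) + 1))))
        = (1 / ((2 * (a:ℝ) + 1) * ((2 * (a:ℝ) + 1) + ((m:ℝ) + 1)))) *
          ((1:ℝ) / (3 ^ (n + 1) * (((2 * a + 1 + m : ℕ):ℝ) + 1 + (n + 1)))) := by
      intro n
      push_cast
      rw [← add_assoc (2 * (a:ℝ) + 1)]
      field_simp
    simp_rw [h2]
    rw [tsum_mul_left, h, ← integral_const_mul]
    congr 1
    ext u
    push_cast
    field_simp
    ring
  simp_rw [e1, step2]
  have hz : ∑' n : ℕ, 1 / ((n:ℝ) + 1) ^ 3 = Li 3 1 := by simp [Li]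
  rw [hz, ← FF_int.2]
  have cL := LL_cont.mono Ioo_subset_Icc_self
  refine nn_lem _ _ (fun a => ?_) ?_ ?_ FF_int.1
  · exact ContinuousOn.mul (by fun_prop) (cL.div (by fun_prop) (fun u hu => by linarith [hu.2]))
  · intro a u hu
    have h1 : 0 < 1 - u := by linarith [hu.2]
    have h3 := hu.1
    have h4 := (LL_bd u hu).1
    positivity
  · intro u hu
    have := ((Real.hasSum_log_sub_log_of_abs_lt_one (abs_lt_of_mem hu)).mul_left (1/2)).mul_right (LL u / (1 - u))
    convert! this using 1
    ext n; ring
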